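/- For a frame L the following are equivalent: (1) every D-sublocale of L is smooth, i.e. S_D(L) ⊆ S_b(L); (2) every sublocale S of L whose frame S has no covered primes (pt_D(S) = ∅) is smooth in L. -/

import Mathlib

open Set

universe u

namespace TD

variable {L : Type u} [Order.Frame L]

/-- A sublocale of a frame `L`: a subset closed under arbitrary meets and
under `a ⇨ -` for every `a : L`. -/
def IsSublocale (S : Set L) : Prop :=
  (∀ A : Set L, A ⊆ S → sInf A ∈ S) ∧ ∀ a : L, ∀ s ∈ S, (a ⇨ s) ∈ S

/-- The covered primes of the (sub)frame `S` (meets computed in `L`,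
which agree with meets in `S` when `S` is a sublocale).  The covered primes
of `L` itself are `ptD (Set.univ)`. -/
def ptD (S : Set L) : Set L :=
  {p | p ∈ S ∧ p ≠ ⊤ ∧ ∀ A : Set L, A ⊆ S → sInf A = p → p ∈ A}

/-- The primes of the (sub)frame `S`.  The primes of `L` itself are
`pt (Set.univ)`. -/
def pt (S : Set L) : Set L :=
  {p | p ∈ S ∧ p ≠ ⊤ ∧ ∀ x ∈ S, ∀ y ∈ S, p = x ⊓ y → p = x ∨ p = y}

/-- A D-sublocale: a sublocale all of whose covered primes are covered primes
of the ambient frame `L`. -/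
def IsDSublocale (S : Set L) : Prop :=
  IsSublocale S ∧ ptD S ⊆ ptD (univ : Set L)

/-- The join, computed in the coframe `S(L)` of all sublocales, of a family of
subsets of `L`: all meets of subsets of the union. -/
def sJoin (𝒮 : Set (Set L)) : Set L :=
  {x | ∃ A : Set L, A ⊆ ⋃₀ 𝒮 ∧ sInf A = x}

/-- Binary join in `S(L)`. -/
def join2 (S T : Set L) : Set L := sJoin {S, T}

/-- The closed sublocale `c(a) = ↑a`. -/
def closedSub (a : L) : Set L := Ici a

/-- The open sublocale `o(a) = {a ⇨ b | b ∈ L}`. -/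
def openSub (a : L) : Set L := {x | ∃ b : L, x = a ⇨ b}

/-- The Boolean sublocale `b(a) = {x ⇨ a | x ∈ L}`. -/
def bSub (a : L) : Set L := {x | ∃ y : L, x = y ⇨ a}

/-- A complemented sublocale: one having a complement in the coframe `S(L)`
(whose bottom is `{⊤}` and top is `L` itself, i.e. `Set.univ`). -/
def IsComplementedSublocale (C : Set L) : Prop :=
  IsSublocale C ∧ ∃ C' : Set L, IsSublocale C' ∧ C ∩ C' = {⊤} ∧ join2 C C' = univ

/-- A smooth sublocale: a join in `S(L)` of complemented sublocales. -/
def IsSmooth (S : Set L) : Prop :=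
  ∃ 𝒞 : Set (Set L), (∀ C ∈ 𝒞, IsComplementedSublocale C) ∧ S = sJoin 𝒞

/-- `M Y`: the closure of `Y` under arbitrary meets (with `⋀ ∅ = ⊤`). -/
def M (Y : Set L) : Set L := {x | ∃ A : Set L, A ⊆ Y ∧ sInf A = x}

/-- The (sub)frame `S` is `T_D`-spatial: every element of `S` is a meet of
covered primes of `S`. -/
def IsTDSpatialSub (S : Set L) : Prop :=
  ∀ s ∈ S, ∃ P : Set L, P ⊆ ptD S ∧ sInf P = s

/-- The (sub)frame `S` is spatial: every element of `S` is a meet of primes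
of `S`. -/
def IsSpatialSub (S : Set L) : Prop :=
  ∀ s ∈ S, ∃ P : Set L, P ⊆ pt S ∧ sInf P = s

/-- The primes of `L` lying above `a`, i.e. `pt(↑a)`. -/
def ptAbove (a : L) : Set L := {p | p ∈ pt (univ : Set L) ∧ a ≤ p}

/-- A prime of the frame `S_D(L)^op` (order-reversed coframe of D-sublocales):
a D-sublocale `P ≠ {⊤}` such that `P = S₁ ∨ S₂` (join in `S(L)`) with
`S₁, S₂` D-sublocales implies `P = S₁` or `P = S₂`. -/
def PrimeInSDop (P : Set L) : Prop :=
  IsDSublocale P ∧ P ≠ ({⊤} : Set L) ∧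
    ∀ S₁ S₂ : Set L, IsDSublocale S₁ → IsDSublocale S₂ →
      P = join2 S₁ S₂ → P = S₁ ∨ P = S₂

/-- A covered prime of the frame `S_D(L)^op`: a D-sublocale `P ≠ {⊤}` such
that whenever `P` is a join of a family of D-sublocales, it equals one of
them. -/
def CovPrimeInSDop (P : Set L) : Prop :=
  IsDSublocale P ∧ P ≠ ({⊤} : Set L) ∧
    ∀ 𝒮 : Set (Set L), (∀ T ∈ 𝒮, IsDSublocale T) → P = sJoin 𝒮 → ∃ T ∈ 𝒮, P = T

/-- A prime of the frame `S(L)^op`. -/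
def PrimeInSop (P : Set L) : Prop :=
  IsSublocale P ∧ P ≠ ({⊤} : Set L) ∧
    ∀ S₁ S₂ : Set L, IsSublocale S₁ → IsSublocale S₂ →
      P = join2 S₁ S₂ → P = S₁ ∨ P = S₂

/-- A prime of the frame `S_b(L)^op` of smooth sublocales. -/
def PrimeInSbop (P : Set L) : Prop :=
  IsSmooth P ∧ P ≠ ({⊤} : Set L) ∧
    ∀ S₁ S₂ : Set L, IsSmooth S₁ → IsSmooth S₂ →
      P = join2 S₁ S₂ → P = S₁ ∨ P = S₂

/-- A prime element of a complete lattice. -/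
def IsPrimeElt {α : Type*} [CompleteLattice α] (p : α) : Prop :=
  p ≠ ⊤ ∧ ∀ x y : α, p = x ⊓ y → p = x ∨ p = y

/-- A `T_D` topological space: `T₀` and every point has an open
neighbourhood `U` with `U \ {x}` open. -/
def IsTDSpace (X : Type*) [TopologicalSpace X] : Prop :=
  T0Space X ∧ ∀ x : X, ∃ U : Set X, IsOpen U ∧ x ∈ U ∧ IsOpen (U \ {x})

/-- A sober space: every prime of the frame of opens is of the form
`X ∖ cl {x}` for a unique point `x`. -/
def IsSoberSpace (X : Type*) [TopologicalSpace X] : Prop :=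
  ∀ p : TopologicalSpace.Opens X, IsPrimeElt p →
    ∃! x : X, p = ⟨(closure {x})ᶜ, isClosed_closure.isOpen_compl⟩


theorem subset_sJoin {𝒮 : Set (Set L)} {C : Set L} (hC : C ∈ 𝒮) : C ⊆ sJoin 𝒮 :=
  fun x hx => ⟨{x}, by rintro y rfl; exact ⟨C, hC, hx⟩, sInf_singleton⟩

theorem sJoin_subset {𝒮 : Set (Set L)} {S : Set L} (hS : ∀ A ⊆ S, sInf A ∈ S)
    (h : ∀ C ∈ 𝒮, C ⊆ S) : sJoin 𝒮 ⊆ S := by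
  rintro _ ⟨A, hA, rfl⟩
  exact hS A (hA.trans (sUnion_subset h))

theorem sInf_mem_sJoin {𝒮 : Set (Set L)} {A : Set L} (hA : A ⊆ sJoin 𝒮) : sInf A ∈ sJoin 𝒮 := by
  refine ⟨{y | y ∈ ⋃₀ 𝒮 ∧ sInf A ≤ y}, fun y hy => hy.1, le_antisymm ?_ (le_sInf fun y hy => hy.2)⟩
  refine le_sInf fun a ha => ?_
  obtain ⟨B, hB, rfl⟩ := hA ha
  exact le_sInf fun b hb => sInf_le ⟨hB hb, (sInf_le ha).trans (sInf_le hb)⟩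

theorem inf_mem_of_sInf_mem {S : Set L} (hS : ∀ A ⊆ S, sInf A ∈ S) {x y : L} (hx : x ∈ S)
    (hy : y ∈ S) : x ⊓ y ∈ S := by
  rw [← sInf_pair]
  exact hS _ (insert_subset hx (singleton_subset_iff.2 hy))

theorem left_subset_join2 (S T : Set L) : S ⊆ join2 S T := subset_sJoin (mem_insert _ _)

theorem right_subset_join2 (S T : Set L) : T ⊆ join2 S T :=
  subset_sJoin (mem_insert_of_mem _ rfl)

theorem join2_subset {S T U : Set L} (hU : ∀ A ⊆ U, sInf A ∈ U) (hS : S ⊆ U) (hT : T ⊆ U) :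
    join2 S T ⊆ U :=
  sJoin_subset hU (by rintro C (rfl | rfl) <;> assumption)

theorem mem_join2 {S T : Set L} (hS : ∀ A ⊆ S, sInf A ∈ S) (hT : ∀ A ⊆ T, sInf A ∈ T) {x : L} :
    x ∈ join2 S T ↔ ∃ s ∈ S, ∃ t ∈ T, s ⊓ t = x := by
  constructor
  · rintro ⟨A, hA, rfl⟩
    refine ⟨sInf (A ∩ S), hS _ inter_subset_right, sInf (A ∩ T), hT _ inter_subset_right, ?_⟩
    have hAST : A ∩ S ∪ A ∩ T = A := by
      rw [← inter_union_distrib_left, inter_eq_left]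
      simpa [join2] using hA
    rw [← sInf_union, hAST]
  · rintro ⟨s, hs, t, ht, rfl⟩
    exact inf_mem_of_sInf_mem (fun A => sInf_mem_sJoin) (left_subset_join2 S T hs)
      (right_subset_join2 S T ht)

theorem IsSublocale.top_mem {S : Set L} (hS : IsSublocale S) : ⊤ ∈ S := by
  simpa using hS.1 ∅ (empty_subset _)

theorem isSublocale_univ : IsSublocale (univ : Set L) :=
  ⟨fun _ _ => mem_univ _, fun _ _ _ => mem_univ _⟩

theorem isSublocale_sInter {𝒮 : Set (Set L)} (h : ∀ S ∈ 𝒮, IsSublocale S) :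
    IsSublocale (⋂₀ 𝒮) :=
  ⟨fun A hA S hS => (h S hS).1 A (hA.trans (sInter_subset_of_mem hS)),
    fun a s hs S hS => (h S hS).2 a s (hs S hS)⟩

/-- The coframe distributive law for binary joins over intersections. -/
theorem sInter_join2_subset {D : Set L} (hD : ∀ A ⊆ D, sInf A ∈ D) {𝒮 : Set (Set L)}
    (h : ∀ S ∈ 𝒮, IsSublocale S) {x : L} (hx : ∀ S ∈ 𝒮, x ∈ join2 D S) :
    x ∈ join2 D (⋂₀ 𝒮) := by
  set d := sInf {y | y ∈ D ∧ x ≤ y}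
  have hxd : x ≤ d := le_sInf fun y hy => hy.2
  refine (mem_join2 hD (isSublocale_sInter h).1).2
    ⟨d, hD _ fun y hy => hy.1, d ⇨ x, fun S hS => ?_, by simpa using hxd⟩
  obtain ⟨e, he, s, hs, hes⟩ := (mem_join2 hD (h S hS).1).1 (hx S hS)
  have hde : d ≤ e := sInf_le ⟨he, hes ▸ inf_le_left⟩
  have hds : d ⊓ s = x :=
    le_antisymm (hes ▸ inf_le_inf_right s hde) (le_inf hxd (hes ▸ inf_le_right))
  have : d ⇨ x = d ⇨ s := by rw [← hds, himp_inf_distrib, himp_self, top_inf_eq]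
  rw [this]
  exact (h S hS).2 d s hs

/-- The complement in the sublocale `S` of the two-element sublocale `{q, ⊤}`
of a covered prime `q` of `S`. -/
def removePoint (S : Set L) (q : L) : Set L := {x | x ∈ S ∧ ∀ a, a ⇨ x ≠ q}

theorem notMem_removePoint (S : Set L) (q : L) : q ∉ removePoint S q :=
  fun h => h.2 ⊤ top_himp

theorem isSublocale_removePoint {S : Set L} (hS : IsSublocale S) {q : L} (hq : q ∈ ptD S) :
    IsSublocale (removePoint S q) := by
  refine ⟨fun A hA => ⟨hS.1 A fun x hx => (hA hx).1, fun a ha => ?_⟩,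
    fun a s hs => ⟨hS.2 a s hs.1, fun b hb => hs.2 (b ⊓ a) (by rw [← hb, himp_himp])⟩⟩
  have hmem : q ∈ (a ⇨ ·) '' A := by
    refine hq.2.2 _ ?_ ?_
    · rintro _ ⟨x, hx, rfl⟩
      exact hS.2 a x (hA hx).1
    · rw [← ha, sInf_image]
      refine le_antisymm ?_ (le_iInf₂ fun x hx => himp_le_himp_left (sInf_le hx))
      rw [le_himp_iff]
      refine le_sInf fun x hx => ?_
      rw [← le_himp_iff]
      exact iInf₂_le x hx
  obtain ⟨x, hx, hxq⟩ := hmem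
  exact (hA hx).2 a hxq

theorem isSublocale_pair {S : Set L} (hS : IsSublocale S) {q : L} (hq : q ∈ ptD S) :
    IsSublocale ({q, ⊤} : Set L) := by
  refine ⟨fun A hA => ?_, fun a s hs => ?_⟩
  · by_cases h : q ∈ A
    · left
      refine le_antisymm (sInf_le h) (le_sInf fun x hx => ?_)
      rcases hA hx with rfl | rfl
      exacts [le_rfl, le_top]
    · right
      refine sInf_eq_top.2 fun x hx => ?_
      rcases hA hx with rfl | rfl
      exacts [absurd hx h, rfl]
  · rcases hs with rfl | rfl
    · have hmem := hq.2.2 {a ⇨ s, (a ⇨ s) ⇨ s} (by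
        rintro x (rfl | rfl)
        exacts [hS.2 _ _ hq.1, hS.2 _ _ hq.1]) (by
        rw [sInf_pair, inf_himp, inf_eq_right]
        exact le_himp)
      rcases hmem with h | h
      · exact Or.inl h.symm
      · right
        refine himp_eq_top_iff.2 ?_
        calc a ≤ (a ⇨ s) ⇨ s := le_himp_himp
          _ = s := h.symm
    · exact Or.inr himp_top

theorem mem_removePoint_or_exists {S : Set L} (hS : IsSublocale S) {q : L} (hq : q ∈ ptD S)
    {x : L} (hx : x ∈ S) : x ∈ removePoint S q ∨ ∃ y ∈ removePoint S q, q ⊓ y = x := by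
  by_cases h : x ∈ removePoint S q
  · exact Or.inl h
  obtain ⟨a, ha⟩ : ∃ a, a ⇨ x = q := by
    by_contra! h'
    exact h ⟨hx, h'⟩
  have hxq : x ≤ q := ha ▸ le_himp
  refine Or.inr ⟨q ⇨ x, ⟨hS.2 q x hx, fun b hb => hq.2.1 ?_⟩, by simpa using hxq⟩
  have hbq : b ⊓ q ≤ x := by
    have : q ≤ b ⇨ q ⇨ x := hb.ge
    rw [le_himp_iff, le_himp_iff] at this
    exact (le_inf (le_inf inf_le_right inf_le_left) inf_le_right).trans this
  rw [← hb, himp_himp, himp_eq_top_iff]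
  exact hbq

theorem isComplementedSublocale_pair {q : L} (hq : q ∈ ptD (univ : Set L)) :
    IsComplementedSublocale ({q, ⊤} : Set L) := by
  have hpair := isSublocale_pair isSublocale_univ hq
  have hrem := isSublocale_removePoint isSublocale_univ hq
  refine ⟨hpair, removePoint univ q, hrem, ?_, ?_⟩
  · ext x
    constructor
    · rintro ⟨rfl | rfl, hx⟩
      exacts [absurd hx (notMem_removePoint _ _), rfl]
    · rintro rfl
      exact ⟨Or.inr rfl, hrem.top_mem⟩
  · refine eq_univ_of_forall fun x => ?_
    rcases mem_removePoint_or_exists isSublocale_univ hq (mem_univ x) with h | ⟨y, hy, h⟩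
    · exact right_subset_join2 _ _ h
    · exact (mem_join2 hpair.1 hrem.1).2 ⟨q, Or.inl rfl, y, hy, h⟩

/-- A covered prime `q` of the summand `T` of `D ∨ T` may be removed from `T`,
provided that `q ∈ D` whenever `q` is a covered prime of `D ∨ T`. -/
theorem subset_join2_removePoint {S D T : Set L} (hD : ∀ A ⊆ D, sInf A ∈ D)
    (hT : IsSublocale T) (hST : S ⊆ join2 D T) (hTS : T ⊆ S) {q : L} (hq : q ∈ ptD T)
    (hqD : q ∈ ptD S → q ∈ D) : S ⊆ join2 D (removePoint T q) := by
  have hR : ∀ A ⊆ join2 D (removePoint T q), sInf A ∈ join2 D (removePoint T q) :=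
    fun A => sInf_mem_sJoin
  have hqR : q ∈ join2 D (removePoint T q) := by
    by_cases hqS : q ∈ ptD S
    · exact left_subset_join2 _ _ (hqD hqS)
    obtain ⟨A, hA, hAq, hqA⟩ : ∃ A ⊆ S, sInf A = q ∧ q ∉ A := by
      by_contra! h
      exact hqS ⟨hTS hq.1, hq.2.1, h⟩
    suffices hAR : sInf A ∈ join2 D (removePoint T q) by rwa [hAq] at hAR
    refine hR A fun y hy => ?_
    obtain ⟨d, hd, t, ht, hdt⟩ := (mem_join2 hD hT.1).1 (hST (hA hy))
    rcases mem_removePoint_or_exists hT hq ht with h | ⟨z, -, hz⟩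
    · exact (mem_join2 hD (isSublocale_removePoint hT hq).1).2 ⟨d, hd, t, h, hdt⟩
    · have hyq : y = q := le_antisymm
        (hdt ▸ inf_le_right.trans (hz ▸ inf_le_left)) (hAq ▸ sInf_le hy)
      exact absurd (hyq ▸ hy) hqA
  refine hST.trans (join2_subset hR (left_subset_join2 _ _) fun t ht => ?_)
  rcases mem_removePoint_or_exists hT hq ht with h | ⟨z, hz, rfl⟩
  · exact right_subset_join2 _ _ h
  · exact inf_mem_of_sInf_mem hR hqR (right_subset_join2 _ _ hz)

/-- `S_D(L) ⊆ S_b(L)` iff every sublocale of `L` without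
covered primes in itself is smooth. -/
theorem D_scattered_iff (L : Type u) [Order.Frame L] :
    (∀ S : Set L, IsDSublocale S → IsSmooth S) ↔
      ∀ S : Set L, IsSublocale S → ptD S = ∅ → IsSmooth S := by
  refine ⟨fun h S hS hpt => h S ⟨hS, by simp [hpt]⟩, fun h S hS => ?_⟩
  let 𝒞 : Set (Set L) := {C | IsComplementedSublocale C ∧ C ⊆ S}
  let 𝒯 : Set (Set L) := {R | IsSublocale R ∧ S ⊆ join2 (sJoin 𝒞) R}
  have hD : ∀ A ⊆ sJoin 𝒞, sInf A ∈ sJoin 𝒞 := fun A => sInf_mem_sJoin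
  have hDS : sJoin 𝒞 ⊆ S := sJoin_subset hS.1.1 fun C hC => hC.2
  have hT : IsSublocale (⋂₀ 𝒯) := isSublocale_sInter fun R hR => hR.1
  have hTS : ⋂₀ 𝒯 ⊆ S := sInter_subset_of_mem ⟨hS.1, right_subset_join2 _ _⟩
  have hST : S ⊆ join2 (sJoin 𝒞) (⋂₀ 𝒯) := fun x hx =>
    sInter_join2_subset hD (fun R hR => hR.1) fun R hR => hR.2 hx
  have hpt : ptD (⋂₀ 𝒯) = ∅ := by
    refine eq_empty_of_forall_notMem fun q hq => notMem_removePoint (⋂₀ 𝒯) q ?_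
    refine hq.1 _ ⟨isSublocale_removePoint hT hq,
      subset_join2_removePoint hD hT hST hTS hq fun hqS => ?_⟩
    refine subset_sJoin (𝒮 := 𝒞) (C := {q, ⊤}) ⟨isComplementedSublocale_pair (hS.2 hqS), ?_⟩ (Or.inl rfl)
    rintro x (rfl | rfl)
    exacts [hqS.1, hS.1.top_mem]
  obtain ⟨𝒟, h𝒟, hT𝒟⟩ := h _ hT hpt
  have hTD : ⋂₀ 𝒯 ⊆ sJoin 𝒞 := by
    have hsub : sJoin 𝒟 ⊆ sJoin 𝒞 := sJoin_subset hD fun C hC =>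
      subset_sJoin ⟨h𝒟 C hC, (subset_sJoin hC).trans (hT𝒟 ▸ hTS)⟩
    rwa [← hT𝒟] at hsub
  exact ⟨𝒞, fun C hC => hC.1, (hST.trans (join2_subset hD subset_rfl hTD)).antisymm hDS⟩

end TD
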